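/- arXiv:2408.09100 — 4 statements merged into one kernel-verified Lean document; each statement's English description precedes it below -/
import Mathlib

section
/- (Overdamped decay estimate.) Let b > 0, m > 0 and let c be a real number with m ≤ c < b²/4, and set D := √(b²/4 − c). Let y : ℝ → ℂ be twice differentiable and satisfy y''(t) + b y'(t) + c y(t) = 0 for all t ≥ 0. Then for every t ≥ 0: |y(t)| ≤ e^{−(b/2)(1−√(1−4m/b²)) t} · ( (1 + b/(4D)) |y(0)| + (1/(2D)) |y'(0)| ). -/
/-- A solution of `u' = r u` on `[0, ∞)` is `u 0 * exp (r t)`. -/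
lemma eq_mul_exp_of_hasDerivAt {u : ℝ → ℂ} {r : ℝ}
    (hu : ∀ t : ℝ, 0 ≤ t → HasDerivAt u (r * u t) t) {t : ℝ} (ht : 0 ≤ t) :
    u t = u 0 * (Real.exp (r * t) : ℝ) := by
  have hderiv : ∀ s : ℝ, 0 ≤ s →
      HasDerivAt (fun s => u s * (Real.exp (-(r * s)) : ℝ)) 0 s := fun s hs => by
    have hexp : HasDerivAt (fun s : ℝ => Real.exp (-(r * s))) (Real.exp (-(r * s)) * -(r * 1)) s :=
      ((hasDerivAt_id s).const_mul r).neg.exp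
    refine ((hu s hs).mul hexp.ofReal_comp).congr_deriv ?_
    push_cast
    ring
  have hconst := constant_of_has_deriv_right_zero
    (fun s hs => (hderiv s hs.1).continuousAt.continuousWithinAt)
    (fun s hs => (hderiv s hs.1).hasDerivWithinAt) t (Set.right_mem_Icc.2 ht)
  simp only [mul_zero, neg_zero, Real.exp_zero, Complex.ofReal_one, mul_one] at hconst
  rw [← hconst, mul_assoc, ← Complex.ofReal_mul, ← Real.exp_add]
  simp

/-- If `r` and `q` are the characteristic roots, then `y' - q y` solves `u' = r u`. -/
lemma deriv_sub_mul_eq_of_char_roots {b c r q : ℝ} (hsum : r + q = -b) (hprod : r * q = c)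
    {y : ℝ → ℂ} (hy : Differentiable ℝ y) (hy' : Differentiable ℝ (deriv y))
    (heq : ∀ t : ℝ, 0 ≤ t →
      deriv (deriv y) t + (b : ℂ) * deriv y t + (c : ℂ) * y t = 0) {t : ℝ} (ht : 0 ≤ t) :
    deriv y t - q * y t = (deriv y 0 - q * y 0) * (Real.exp (r * t) : ℝ) := by
  refine eq_mul_exp_of_hasDerivAt (u := fun s => deriv y s - q * y s) (fun s hs => ?_) ht
  refine ((hy' s).hasDerivAt.sub ((hy s).hasDerivAt.const_mul (q : ℂ))).congr_deriv ?_
  have hb : (b : ℂ) = -(r + q) := by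
    rw [← Complex.ofReal_add, hsum, Complex.ofReal_neg, neg_neg]
  have hc : (c : ℂ) = r * q := by rw [← Complex.ofReal_mul, hprod]
  have h := heq s hs
  rw [hb, hc] at h
  linear_combination h

/-- The decay estimate at the rate of the slower characteristic root `-b/2 + D`. -/
lemma norm_le_exp_slow_root {b c D : ℝ} (hb : 0 ≤ b) (hD : 0 < D) (hDc : D ^ 2 = b ^ 2 / 4 - c)
    {y : ℝ → ℂ} (hy : Differentiable ℝ y) (hy' : Differentiable ℝ (deriv y))
    (heq : ∀ t : ℝ, 0 ≤ t →
      deriv (deriv y) t + (b : ℂ) * deriv y t + (c : ℂ) * y t = 0) {t : ℝ} (ht : 0 ≤ t) :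
    ‖y t‖ ≤ Real.exp ((-(b / 2) + D) * t) *
      ((1 + b / (4 * D)) * ‖y 0‖ + (1 / (2 * D)) * ‖deriv y 0‖) := by
  have hslow := deriv_sub_mul_eq_of_char_roots (r := -(b / 2) + D) (q := -(b / 2) - D)
    (by ring) (by linear_combination -hDc) hy hy' heq ht
  have hfast := deriv_sub_mul_eq_of_char_roots (r := -(b / 2) - D) (q := -(b / 2) + D)
    (by ring) (by linear_combination -hDc) hy hy' heq ht
  have hsplit : Real.exp ((-(b / 2) - D) * t) =
      Real.exp ((-(b / 2) + D) * t) * Real.exp (-(2 * D * t)) := by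
    rw [← Real.exp_add]
    ring_nf
  have hE1 : Real.exp (-(2 * D * t)) ≤ 1 :=
    Real.exp_le_one_iff.2 (neg_nonpos.2 (by positivity))
  have hE0 := Real.exp_pos (-(2 * D * t))
  have hP := Real.exp_pos ((-(b / 2) + D) * t)
  rw [hsplit] at hfast
  generalize Real.exp (-(2 * D * t)) = E at *
  generalize Real.exp ((-(b / 2) + D) * t) = P at *
  have hsol : ((2 * D : ℝ) : ℂ) * y t = (P : ℝ) *
      ((deriv y 0 + ((b / 2 : ℝ) : ℂ) * y 0) * ((1 - E : ℝ) : ℂ) +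
        (D : ℂ) * y 0 * ((1 + E : ℝ) : ℂ)) := by
    push_cast at *
    linear_combination hslow - hfast
  have hnorm : 2 * D * ‖y t‖ ≤ P * ((‖deriv y 0‖ + b / 2 * ‖y 0‖) * 1 + D * ‖y 0‖ * 2) := by
    calc 2 * D * ‖y t‖ = ‖((2 * D : ℝ) : ℂ) * y t‖ := by
          rw [norm_mul, Complex.norm_of_nonneg (by positivity)]
      _ ≤ P * ((‖deriv y 0‖ + b / 2 * ‖y 0‖) * (1 - E) + D * ‖y 0‖ * (1 + E)) := by
          rw [hsol, norm_mul, Complex.norm_of_nonneg hP.le]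
          gcongr
          refine (norm_add_le _ _).trans ?_
          rw [norm_mul, norm_mul, norm_mul, Complex.norm_of_nonneg (sub_nonneg.2 hE1),
            Complex.norm_of_nonneg hD.le, Complex.norm_of_nonneg (by positivity : 0 ≤ 1 + E)]
          gcongr
          refine (norm_add_le _ _).trans_eq ?_
          rw [norm_mul, Complex.norm_of_nonneg (by positivity)]
      _ ≤ _ := by
          gcongr <;> linarith
  refine le_of_mul_le_mul_left (hnorm.trans_eq ?_) (by positivity : 0 < 2 * D)
  field_simp
  ring


/-- Overdamped decay estimate for the damped oscillator `y'' + b y' + c y = 0` with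
`m ≤ c < b²/4`, `D = √(b²/4 − c)`:
`|y(t)| ≤ e^{−(b/2)(1−√(1−4m/b²)) t} ((1 + b/(4D)) |y(0)| + (1/(2D)) |y'(0)|)`. -/
theorem overdamped_decay (b m c : ℝ) (hb : 0 < b) (hm : 0 < m)
    (hmc : m ≤ c) (hc : c < b ^ 2 / 4)
    (y : ℝ → ℂ) (hy : Differentiable ℝ y) (hy' : Differentiable ℝ (deriv y))
    (heq : ∀ t : ℝ, 0 ≤ t →
      deriv (deriv y) t + (b : ℂ) * deriv y t + (c : ℂ) * y t = 0) :
    ∀ t : ℝ, 0 ≤ t →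
      ‖y t‖ ≤ Real.exp (-(b / 2) * (1 - Real.sqrt (1 - 4 * m / b ^ 2)) * t) *
        ((1 + b / (4 * Real.sqrt (b ^ 2 / 4 - c))) * ‖y 0‖
          + (1 / (2 * Real.sqrt (b ^ 2 / 4 - c))) * ‖deriv y 0‖) := by
  intro t ht
  have hD : 0 < b ^ 2 / 4 - c := by linarith
  refine (norm_le_exp_slow_root hb.le (Real.sqrt_pos.2 hD) (Real.sq_sqrt hD.le)
    hy hy' heq ht).trans ?_
  have hrate : Real.sqrt (b ^ 2 / 4 - c) ≤ b / 2 * Real.sqrt (1 - 4 * m / b ^ 2) := by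
    rw [← Real.sqrt_sq (by positivity : 0 ≤ b / 2)]
    rw [← Real.sqrt_mul (sq_nonneg (b / 2))]
    refine Real.sqrt_le_sqrt ?_
    have : (b / 2) ^ 2 * (1 - 4 * m / b ^ 2) = b ^ 2 / 4 - m := by
      field_simp
      ring
    linarith
  gcongr
  linarith
end

section
/- (Uniform exponential decay for the damped oscillator.) For all b > 0 and m > 0 there exist constants C > 0 and δ > 0, depending only on b and m, such that for every real c ≥ m and every twice differentiable y : ℝ → ℂ satisfying y''(t) + b y'(t) + c y(t) = 0 for all t ≥ 0, one has (1+c)^{1/2} |y(t)| ≤ C e^{−δt} ( (1+c)^{1/2} |y(0)| + |y'(0)| ) for all t ≥ 0. -/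
open scoped RealInnerProductSpace

namespace DampedOscillator

variable {E : Type*} [NormedAddCommGroup E] [InnerProductSpace ℝ E]

/-- The modified energy of position `x` and velocity `v`; it equals
`‖v + (b / 2) • x‖ ^ 2 + (c + b ^ 2 / 4) * ‖x‖ ^ 2`. -/
noncomputable def energy (b c : ℝ) (x v : E) : ℝ :=
  ‖v‖ ^ 2 + (c + b ^ 2 / 2) * ‖x‖ ^ 2 + b * ⟪x, v⟫

theorem mul_norm_sq_le_energy (b c : ℝ) (x v : E) : c * ‖x‖ ^ 2 ≤ energy b c x v := by
  have h := norm_add_sq_real v ((b / 2) • x)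
  rw [norm_smul, mul_pow, Real.norm_eq_abs, sq_abs, inner_smul_right, real_inner_comm] at h
  unfold energy
  nlinarith [sq_nonneg ‖v + (b / 2) • x‖, mul_nonneg (sq_nonneg b) (sq_nonneg ‖x‖)]

theorem energy_le {b m c : ℝ} (hm : 0 < m) (hc : m ≤ c) (x v : E) :
    energy b c x v ≤ (2 + 3 * b ^ 2 / (4 * m)) * (‖v‖ ^ 2 + c * ‖x‖ ^ 2) := by
  have h := norm_sub_sq_real v ((b / 2) • x)
  rw [norm_smul, mul_pow, Real.norm_eq_abs, sq_abs, inner_smul_right, real_inner_comm] at h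
  have h₁ : 3 * b ^ 2 / 4 ≤ 3 * b ^ 2 / (4 * m) * c := by
    rw [div_mul_eq_mul_div, div_le_div_iff₀ (by norm_num) (by positivity)]
    nlinarith [mul_le_mul_of_nonneg_left hc (sq_nonneg b)]
  have h₂ : 0 ≤ 3 * b ^ 2 / (4 * m) * ‖v‖ ^ 2 := by positivity
  have h₃ : 0 ≤ c * ‖x‖ ^ 2 := mul_nonneg (hm.le.trans hc) (sq_nonneg _)
  unfold energy
  nlinarith [sq_nonneg ‖v - (b / 2) • x‖, mul_le_mul_of_nonneg_right h₁ (sq_nonneg ‖x‖)]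

theorem hasDerivAt_energy {b c t : ℝ} {y v : ℝ → E} (hy : HasDerivAt y (v t) t)
    (hv : HasDerivAt v (-(b • v t) - c • y t) t) :
    HasDerivAt (fun s => energy b c (y s) (v s)) (-b * (‖v t‖ ^ 2 + c * ‖y t‖ ^ 2)) t := by
  have h := (hv.norm_sq.add (hy.norm_sq.const_mul (c + b ^ 2 / 2))).add
    ((hy.inner ℝ hv).const_mul b)
  refine h.congr_deriv ?_
  simp only [inner_sub_right, inner_neg_right, inner_smul_right, real_inner_self_eq_norm_sq,
    real_inner_comm (v t) (y t)]
  ring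

theorem energy_le_exp_mul {b m c : ℝ} (hb : 0 < b) (hm : 0 < m) (hc : m ≤ c) {y v : ℝ → E}
    (hy : ∀ t, 0 ≤ t → HasDerivAt y (v t) t)
    (hv : ∀ t, 0 ≤ t → HasDerivAt v (-(b • v t) - c • y t) t) {t : ℝ} (ht : 0 ≤ t) :
    energy b c (y t) (v t) ≤
      Real.exp (-(b / (2 + 3 * b ^ 2 / (4 * m))) * t) * energy b c (y 0) (v 0) := by
  set K := 2 + 3 * b ^ 2 / (4 * m) with hK
  have hK0 : 0 < K := by positivity
  have hF (s : ℝ) (hs : 0 ≤ s) :=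
    ((hasDerivAt_id s).const_mul (b / K)).exp.mul (hasDerivAt_energy (hy s hs) (hv s hs))
  have hanti : AntitoneOn
      (fun s => Real.exp (b / K * s) * energy b c (y s) (v s)) (Set.Ici 0) := by
    refine antitoneOn_of_hasDerivWithinAt_nonpos (convex_Ici 0)
      (fun s hs => (hF s hs).continuousAt.continuousWithinAt)
      (fun s hs => (hF s (interior_subset hs)).hasDerivWithinAt) fun s _ => ?_
    have h := mul_le_mul_of_nonneg_left (energy_le (b := b) hm hc (y s) (v s)) (div_pos hb hK0).le
    rw [← hK, ← mul_assoc, div_mul_cancel₀ _ hK0.ne'] at h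
    have h' := mul_le_mul_of_nonneg_left h (Real.exp_pos (b / K * s)).le
    simp only [id]
    linarith
  have h := hanti Set.self_mem_Ici ht ht
  simp only [mul_zero, Real.exp_zero, one_mul] at h
  rw [neg_mul, Real.exp_neg, ← div_eq_inv_mul, le_div_iff₀ (Real.exp_pos _)]
  linarith

/-- Exponential decay of the position, with constants uniform in the frequency `c ≥ m`. -/
theorem sqrt_mul_norm_le {b m c : ℝ} (hb : 0 < b) (hm : 0 < m) (hc : m ≤ c) {y v : ℝ → E}
    (hy : ∀ t, 0 ≤ t → HasDerivAt y (v t) t)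
    (hv : ∀ t, 0 ≤ t → HasDerivAt v (-(b • v t) - c • y t) t) {t : ℝ} (ht : 0 ≤ t) :
    Real.sqrt (1 + c) * ‖y t‖ ≤
      Real.sqrt ((1 + 1 / m) * (2 + 3 * b ^ 2 / (4 * m))) *
        Real.exp (-(b / (2 + 3 * b ^ 2 / (4 * m)) / 2) * t) *
          (Real.sqrt (1 + c) * ‖y 0‖ + ‖v 0‖) := by
  have hlo := mul_norm_sq_le_energy b c (y t) (v t)
  have hdecay := energy_le_exp_mul hb hm hc hy hv ht
  have hhi := energy_le (b := b) hm hc (y 0) (v 0)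
  set K := 2 + 3 * b ^ 2 / (4 * m)
  have hK0 : 0 < K := by positivity
  have hc0 : 0 < c := hm.trans_le hc
  have hexp : Real.exp (-(b / K / 2) * t) ^ 2 = Real.exp (-(b / K) * t) := by
    rw [← Real.exp_nat_mul]
    congr 1
    push_cast
    ring
  have hfreq : 1 + c ≤ (1 + 1 / m) * c := by
    have : 1 ≤ 1 / m * c := by rwa [div_mul_eq_mul_div, one_mul, one_le_div₀ hm]
    linarith
  have hinit : ‖v 0‖ ^ 2 + c * ‖y 0‖ ^ 2 ≤ (Real.sqrt (1 + c) * ‖y 0‖ + ‖v 0‖) ^ 2 := by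
    have hs : Real.sqrt (1 + c) ^ 2 = 1 + c := Real.sq_sqrt (by positivity)
    have hx : 0 ≤ Real.sqrt (1 + c) * ‖y 0‖ * ‖v 0‖ := by positivity
    rw [add_sq, mul_pow, hs]
    nlinarith [sq_nonneg ‖y 0‖]
  refine (sq_le_sq₀ (by positivity) (by positivity)).mp ?_
  calc (Real.sqrt (1 + c) * ‖y t‖) ^ 2 = (1 + c) * ‖y t‖ ^ 2 := by
        rw [mul_pow, Real.sq_sqrt (by positivity)]
    _ ≤ (1 + 1 / m) * (c * ‖y t‖ ^ 2) := by
        rw [← mul_assoc]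
        gcongr
    _ ≤ (1 + 1 / m) * (Real.exp (-(b / K) * t) *
          (K * (Real.sqrt (1 + c) * ‖y 0‖ + ‖v 0‖) ^ 2)) := by
        refine mul_le_mul_of_nonneg_left (hlo.trans (hdecay.trans ?_)) (by positivity)
        gcongr
        exact hhi.trans (by gcongr)
    _ = _ := by
        rw [mul_pow, mul_pow, Real.sq_sqrt (by positivity), hexp]
        ring

end DampedOscillator

/-- Uniform exponential decay for the damped oscillator: for `b, m > 0` there are
`C, δ > 0` depending only on `b` and `m` such that every solution of
`y'' + b y' + c y = 0` with `c ≥ m` satisfies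
`(1+c)^{1/2} |y(t)| ≤ C e^{−δt} ((1+c)^{1/2} |y(0)| + |y'(0)|)` for all `t ≥ 0`. -/
theorem damped_oscillator_uniform_decay (b m : ℝ) (hb : 0 < b) (hm : 0 < m) :
    ∃ C > (0 : ℝ), ∃ δ > (0 : ℝ), ∀ c : ℝ, m ≤ c →
      ∀ y : ℝ → ℂ, Differentiable ℝ y → Differentiable ℝ (deriv y) →
        (∀ t : ℝ, 0 ≤ t →
          deriv (deriv y) t + (b : ℂ) * deriv y t + (c : ℂ) * y t = 0) →
        ∀ t : ℝ, 0 ≤ t →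
          Real.sqrt (1 + c) * ‖y t‖ ≤
            C * Real.exp (-δ * t) * (Real.sqrt (1 + c) * ‖y 0‖ + ‖deriv y 0‖) := by
  refine ⟨Real.sqrt ((1 + 1 / m) * (2 + 3 * b ^ 2 / (4 * m))), by positivity,
    b / (2 + 3 * b ^ 2 / (4 * m)) / 2, by positivity, fun c hc y hy hy' hode t ht => ?_⟩
  refine DampedOscillator.sqrt_mul_norm_le hb hm hc (fun s _ => (hy s).hasDerivAt)
    (fun s hs => (hy' s).hasDerivAt.congr_deriv ?_) ht
  rw [Complex.real_smul, Complex.real_smul]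
  linear_combination hode s hs
end

section
/- (Uniform exponential decay for the time derivative.) For all b > 0 and m > 0 there exist constants C > 0 and δ > 0, depending only on b and m, such that for every real c ≥ m and every twice differentiable y : ℝ → ℂ satisfying y''(t) + b y'(t) + c y(t) = 0 for all t ≥ 0, one has |y'(t)| ≤ C e^{−δt} ( (1+c)^{1/2} |y(0)| + |y'(0)| ) for all t ≥ 0. -/
section

open scoped RealInnerProductSpace

variable {E : Type*} [NormedAddCommGroup E] [InnerProductSpace ℝ E]

/-- The energy of the oscillator at position `u` and velocity `v`, perturbed by a small
multiple of the inner product of `u` and `v`. -/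
noncomputable def perturbedEnergy (c ε : ℝ) (u v : E) : ℝ :=
  ‖v‖ ^ 2 + c * ‖u‖ ^ 2 + 2 * ε * ⟪u, v⟫

lemma abs_two_mul_inner_le {p q k : ℝ} (hp : 0 < p) (hk : k ^ 2 ≤ p * q) (u v : E) :
    |2 * k * ⟪u, v⟫| ≤ p * ‖v‖ ^ 2 + q * ‖u‖ ^ 2 := by
  have h : |2 * k * ⟪u, v⟫| ≤ 2 * |k| * (‖u‖ * ‖v‖) := by
    rw [abs_mul, abs_mul, abs_two]
    gcongr
    exact abs_real_inner_le_norm u v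
  refine h.trans (le_of_mul_le_mul_left ?_ hp)
  have hu : k ^ 2 * ‖u‖ ^ 2 ≤ p * q * ‖u‖ ^ 2 := by gcongr
  nlinarith [sq_nonneg (p * ‖v‖ - |k| * ‖u‖), sq_abs k]

lemma abs_perturbedEnergy_sub_le {c ε : ℝ} (hε : 4 * ε ^ 2 ≤ c) (u v : E) :
    |perturbedEnergy c ε u v - (‖v‖ ^ 2 + c * ‖u‖ ^ 2)| ≤ (‖v‖ ^ 2 + c * ‖u‖ ^ 2) / 2 := by
  have h := abs_two_mul_inner_le (p := 1 / 2) (q := c / 2) (k := ε) (by norm_num)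
    (by linarith) u v
  rw [perturbedEnergy, add_sub_cancel_left]
  linarith

lemma hasDerivAt_perturbedEnergy {b c ε t : ℝ} {y v : ℝ → E} {w : E}
    (hy : HasDerivAt y (v t) t) (hv : HasDerivAt v w t) (h : w + b • v t + c • y t = 0) :
    HasDerivAt (fun s => perturbedEnergy c ε (y s) (v s))
      (-(2 * (b - ε) * ‖v t‖ ^ 2 + 2 * ε * c * ‖y t‖ ^ 2 + 2 * (ε * b) * ⟪y t, v t⟫)) t := by
  have hw : w = -(b • v t) - c • y t := by
    rw [← sub_eq_zero, ← h]; abel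
  have hE := (hv.norm_sq.add (hy.norm_sq.const_mul c)).add
    ((hy.inner ℝ hv).const_mul (2 * ε))
  refine hE.congr_deriv ?_
  simp only [hw, inner_sub_right, inner_neg_right, real_inner_smul_right,
    real_inner_self_eq_norm_sq, real_inner_comm (y t) (v t)]
  ring

lemma perturbedEnergy_le_exp_mul {b c ε : ℝ} (hb : 0 < b) (hε : 0 < ε) (hεb : 3 * ε ≤ b)
    (hεc : ε * b ≤ c) {y v w : ℝ → E} (hy : ∀ t, 0 ≤ t → HasDerivAt y (v t) t)
    (hv : ∀ t, 0 ≤ t → HasDerivAt v (w t) t)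
    (h : ∀ t, 0 ≤ t → w t + b • v t + c • y t = 0) {t : ℝ} (ht : 0 ≤ t) :
    perturbedEnergy c ε (y t) (v t) ≤
      Real.exp (-(ε * t)) * perturbedEnergy c ε (y 0) (v 0) := by
  have hexp (s : ℝ) : HasDerivAt (fun s => Real.exp (ε * s)) (Real.exp (ε * s) * ε) s := by
    simpa using ((hasDerivAt_id s).const_mul ε).exp
  have hderiv (s : ℝ) (hs : 0 ≤ s) :=
    (hexp s).mul (hasDerivAt_perturbedEnergy (ε := ε) (hy s hs) (hv s hs) (h s hs))
  have hanti : AntitoneOn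
      ((fun s => Real.exp (ε * s)) * fun s => perturbedEnergy c ε (y s) (v s)) (Set.Ici 0) := by
    refine antitoneOn_of_deriv_nonpos (convex_Ici 0)
      (fun s hs => (hderiv s hs).continuousAt.continuousWithinAt)
      (fun s hs => (hderiv s (interior_subset hs)).differentiableAt.differentiableWithinAt)
      fun s hs => ?_
    rw [(hderiv s (interior_subset hs)).deriv]
    have hk : (ε * (b - ε)) ^ 2 ≤ b * (ε * c) := by
      have h1 : (b - ε) ^ 2 ≤ b ^ 2 := by gcongr <;> linarith
      calc (ε * (b - ε)) ^ 2 = ε ^ 2 * (b - ε) ^ 2 := by ring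
        _ ≤ ε ^ 2 * b ^ 2 := by gcongr
        _ = b * (ε * (ε * b)) := by ring
        _ ≤ b * (ε * c) := by gcongr
    have hcross := (abs_le.mp (abs_two_mul_inner_le hb hk (y s) (v s))).1
    have hv2 : 0 ≤ (b - 3 * ε) * ‖v s‖ ^ 2 := mul_nonneg (by linarith) (sq_nonneg _)
    rw [mul_assoc, ← mul_add]
    refine mul_nonpos_of_nonneg_of_nonpos (Real.exp_nonneg _) ?_
    rw [perturbedEnergy]
    linarith
  have h0 := hanti Set.self_mem_Ici ht ht
  simp only [Pi.mul_apply, mul_zero, Real.exp_zero, one_mul] at h0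
  rwa [Real.exp_neg, ← div_eq_inv_mul, le_div_iff₀ (Real.exp_pos _), mul_comm]

end

/-- Uniform exponential decay for the time derivative of solutions of the damped
oscillator: for `b, m > 0` there are `C, δ > 0` depending only on `b` and `m` such that
every solution of `y'' + b y' + c y = 0` with `c ≥ m` satisfies
`|y'(t)| ≤ C e^{−δt} ((1+c)^{1/2} |y(0)| + |y'(0)|)` for all `t ≥ 0`. -/
theorem damped_oscillator_uniform_decay_deriv (b m : ℝ) (hb : 0 < b) (hm : 0 < m) :
    ∃ C > (0 : ℝ), ∃ δ > (0 : ℝ), ∀ c : ℝ, m ≤ c →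
      ∀ y : ℝ → ℂ, Differentiable ℝ y → Differentiable ℝ (deriv y) →
        (∀ t : ℝ, 0 ≤ t →
          deriv (deriv y) t + (b : ℂ) * deriv y t + (c : ℂ) * y t = 0) →
        ∀ t : ℝ, 0 ≤ t →
          ‖deriv y t‖ ≤
            C * Real.exp (-δ * t) * (Real.sqrt (1 + c) * ‖y 0‖ + ‖deriv y 0‖) := by
  obtain ⟨ε, hε, hεb, hεm⟩ : ∃ ε > 0, 3 * ε ≤ b ∧ 2 * (ε * b) ≤ m := by
    refine ⟨min (b / 3) (m / (2 * b)), by positivity, ?_, ?_⟩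
    · linarith [min_le_left (b / 3) (m / (2 * b))]
    · have := (le_div_iff₀ (by positivity)).mp (min_le_right (b / 3) (m / (2 * b)))
      linarith
  refine ⟨2, two_pos, ε / 2, half_pos hε, fun c hc y hy hy' h t ht => ?_⟩
  have hεc : 4 * ε ^ 2 ≤ c := by nlinarith
  have hdecay := perturbedEnergy_le_exp_mul hb hε hεb (by nlinarith : ε * b ≤ c)
    (fun s _ => (hy s).hasDerivAt) (fun s _ => (hy' s).hasDerivAt)
    (fun s hs => by simpa only [Complex.real_smul] using h s hs) ht
  have hlower := (abs_le.mp (abs_perturbedEnergy_sub_le hεc (y t) (deriv y t))).1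
  have hupper := (abs_le.mp (abs_perturbedEnergy_sub_le hεc (y 0) (deriv y 0))).2
  have hyt : 0 ≤ c * ‖y t‖ ^ 2 := mul_nonneg (by linarith) (sq_nonneg _)
  have hsqrt : Real.sqrt (1 + c) ^ 2 = 1 + c := Real.sq_sqrt (by linarith)
  have hexp : Real.exp (-(ε / 2) * t) ^ 2 = Real.exp (-(ε * t)) := by
    rw [← Real.exp_nat_mul]; congr 1; push_cast; ring
  have hinit : ‖deriv y 0‖ ^ 2 + c * ‖y 0‖ ^ 2 ≤
      (Real.sqrt (1 + c) * ‖y 0‖ + ‖deriv y 0‖) ^ 2 := by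
    have : 0 ≤ Real.sqrt (1 + c) * ‖y 0‖ * ‖deriv y 0‖ := by positivity
    rw [add_sq, mul_pow, hsqrt]
    linarith [sq_nonneg ‖y 0‖]
  refine (sq_le_sq₀ (norm_nonneg _) (by positivity)).mp ?_
  calc ‖deriv y t‖ ^ 2 ≤ 2 * perturbedEnergy c ε (y t) (deriv y t) := by linarith
    _ ≤ 2 * (Real.exp (-(ε * t)) * perturbedEnergy c ε (y 0) (deriv y 0)) := by gcongr
    _ ≤ 2 * (Real.exp (-(ε * t)) *
          (2 * (Real.sqrt (1 + c) * ‖y 0‖ + ‖deriv y 0‖) ^ 2)) := by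
      gcongr
      have := sq_nonneg (Real.sqrt (1 + c) * ‖y 0‖ + ‖deriv y 0‖)
      linarith
    _ = (2 * Real.exp (-(ε / 2) * t) *
          (Real.sqrt (1 + c) * ‖y 0‖ + ‖deriv y 0‖)) ^ 2 := by
      rw [mul_pow, mul_pow, hexp]; ring
end

section
/- (Sobolev-norm decay for the linear damped wave equation on the Fourier side.) Let d ≥ 1 be an integer, b > 0, m > 0 and s ∈ ℝ. There exist constants C > 0 and δ > 0, depending only on b and m, with the following property. Suppose u : [0,∞) × ℝ^d → ℂ and u₀, u₁ : ℝ^d → ℂ are such that for every ξ ∈ ℝ^d the function t ↦ u(t,ξ) is twice differentiable and satisfies ∂²_t u(t,ξ) + b ∂_t u(t,ξ) + (m + |ξ|²) u(t,ξ) = 0 for all t ≥ 0, with u(0,ξ) = u₀(ξ) and ∂_t u(0,ξ) = u₁(ξ), and that u(t,·), u₀, u₁ are measurable. Then for every t ≥ 0: (∫_{ℝ^d} (1+|ξ|²)^s |u(t,ξ)|² dξ)^{1/2} ≤ C e^{−δt} [ (∫_{ℝ^d} (1+|ξ|²)^s |u₀(ξ)|² dξ)^{1/2} + (∫_{ℝ^d}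 (1+|ξ|²)^{s−1} |u₁(ξ)|² dξ)^{1/2} ], where all integrals are Lebesgue integrals with values in [0,∞]. -/
open MeasureTheory
open scoped ENNReal

/-- The mixed energy of a damped oscillator dominates, and is dominated by, the usual energy. -/
theorem damped_oscillator_energy_bounds {E : Type*} [NormedAddCommGroup E] [InnerProductSpace ℝ E]
    {a M : ℝ} (ha : 0 < a) (haM : 4 * a ^ 2 ≤ M) (x v : E) :
    M * ‖x‖ ^ 2 ≤ 2 * (‖v‖ ^ 2 + M * ‖x‖ ^ 2 + 2 * a * inner ℝ x v) ∧
      2 * (‖v‖ ^ 2 + M * ‖x‖ ^ 2 + 2 * a * inner ℝ x v) ≤ 3 * (‖v‖ ^ 2 + M * ‖x‖ ^ 2) := by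
  have h := abs_le.mp (abs_real_inner_le_norm x v)
  have h1 := mul_le_mul_of_nonneg_left h.1 ha.le
  have h2 := mul_le_mul_of_nonneg_left h.2 ha.le
  have h3 := mul_le_mul_of_nonneg_right haM (sq_nonneg ‖x‖)
  constructor <;> nlinarith [sq_nonneg (2 * a * ‖x‖ - ‖v‖)]

/-- Exponential decay for a damped oscillator `f'' + b f' + M f = 0` on `[0, ∞)`. -/
theorem damped_oscillator_decay {E : Type*} [NormedAddCommGroup E] [InnerProductSpace ℝ E]
    {a b M : ℝ} (ha : 0 < a) (hab : 3 * a ≤ b) (habM : 3 * (a * b) ≤ M) {f : ℝ → E}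
    (hf : Differentiable ℝ f) (hf' : Differentiable ℝ (deriv f))
    (hode : ∀ t, 0 ≤ t → deriv (deriv f) t + b • deriv f t + M • f t = 0)
    {t : ℝ} (ht : 0 ≤ t) :
    M * ‖f t‖ ^ 2 ≤ 3 * Real.exp (-a * t) * (‖deriv f 0‖ ^ 2 + M * ‖f 0‖ ^ 2) := by
  set v := deriv f with hv
  have hb : 0 < b := by linarith
  have haM : 4 * a ^ 2 ≤ M := by nlinarith
  have hM : 0 < M := by nlinarith
  let G : ℝ → ℝ := fun t => ‖v t‖ ^ 2 + M * ‖f t‖ ^ 2 + 2 * a * inner ℝ (f t) (v t)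
  let F : ℝ → ℝ := fun t => Real.exp (a * t) * G t
  have hF : ∀ t, HasDerivAt F (Real.exp (a * t) * a * G t + Real.exp (a * t) *
      (2 * inner ℝ (v t) (deriv v t) + M * (2 * inner ℝ (f t) (v t)) +
        2 * a * (inner ℝ (f t) (deriv v t) + inner ℝ (v t) (v t)))) t := by
    intro t
    have h1 := (hf t).hasDerivAt
    have h2 := (hf' t).hasDerivAt
    have h3 : HasDerivAt (fun t : ℝ => Real.exp (a * t)) (Real.exp (a * t) * a) t := by
      simpa using ((hasDerivAt_id t).const_mul a).exp
    exact h3.mul ((h2.norm_sq.add (h1.norm_sq.const_mul M)).add ((h1.inner ℝ h2).const_mul (2 * a)))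
  have hanti : AntitoneOn F (Set.Ici 0) := by
    refine antitoneOn_of_deriv_nonpos (convex_Ici 0)
      (fun t _ => (hF t).continuousAt.continuousWithinAt)
      (fun t _ => (hF t).differentiableAt.differentiableWithinAt) fun t ht => ?_
    rw [interior_Ici] at ht
    rw [(hF t).deriv]
    have hvd : deriv v t = -(b • v t) - M • f t := by
      rw [eq_sub_iff_add_eq, eq_neg_iff_add_eq_zero, ← hode t (le_of_lt ht)]
      abel
    rw [hvd, mul_assoc, ← mul_add]
    refine mul_nonpos_of_nonneg_of_nonpos (Real.exp_pos _).le ?_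
    simp only [G, inner_sub_right, inner_neg_right, real_inner_smul_right,
      real_inner_self_eq_norm_sq, real_inner_comm (f t) (v t)]
    have h := (abs_le.mp (abs_real_inner_le_norm (f t) (v t))).1
    have hc : 0 ≤ a * (b - a) := by nlinarith
    have h1 := mul_le_mul_of_nonneg_left h hc
    have h2 : 0 ≤ (b - 3 * a) * ‖v t‖ ^ 2 := by
      exact mul_nonneg (by linarith) (sq_nonneg _)
    have h3 := mul_le_mul_of_nonneg_right habM (mul_nonneg ha.le (sq_nonneg ‖f t‖))
    have h4 := mul_nonneg hb.le (sq_nonneg (‖v t‖ - a * ‖f t‖))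
    have h5 : 0 ≤ a ^ 2 * (‖f t‖ * ‖v t‖) := by positivity
    have h6 : 0 ≤ a ^ 2 * b * ‖f t‖ ^ 2 := by positivity
    nlinarith
  have hle : F t ≤ F 0 := hanti Set.self_mem_Ici ht ht
  have hG : G t ≤ Real.exp (-a * t) * G 0 := by
    have h := mul_le_mul_of_nonneg_left hle (Real.exp_pos (-a * t)).le
    simpa [F, ← mul_assoc, ← Real.exp_add] using h
  have hlow := (damped_oscillator_energy_bounds ha haM (f t) (v t)).1
  have hup := mul_le_mul_of_nonneg_left (damped_oscillator_energy_bounds ha haM (f 0) (v 0)).2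
    (Real.exp_pos (-a * t)).le
  simp only [G] at hG
  linarith

/-- A pointwise weighted square bound yields a bound between weighted `L²` quantities. -/
theorem lintegral_rpow_half_le_of_le_add {α : Type*} [MeasurableSpace α] {μ : Measure α}
    {f g h : α → ℝ≥0∞} (hg : AEMeasurable g μ) {c : ℝ} (hc : 0 ≤ c)
    (hfgh : ∀ x, f x ≤ ENNReal.ofReal (c ^ 2) * (g x + h x)) :
    (∫⁻ x, f x ∂μ) ^ (1 / 2 : ℝ) ≤ ENNReal.ofReal c *
      ((∫⁻ x, g x ∂μ) ^ (1 / 2 : ℝ) + (∫⁻ x, h x ∂μ) ^ (1 / 2 : ℝ)) := by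
  have hint : ∫⁻ x, f x ∂μ ≤ ENNReal.ofReal (c ^ 2) * (∫⁻ x, g x ∂μ + ∫⁻ x, h x ∂μ) := by
    rw [← lintegral_add_left' hg, ← lintegral_const_mul' _ _ ENNReal.ofReal_ne_top]
    exact lintegral_mono hfgh
  calc (∫⁻ x, f x ∂μ) ^ (1 / 2 : ℝ)
      ≤ (ENNReal.ofReal (c ^ 2) * (∫⁻ x, g x ∂μ + ∫⁻ x, h x ∂μ)) ^ (1 / 2 : ℝ) :=
        ENNReal.rpow_le_rpow hint (by norm_num)
    _ = ENNReal.ofReal c * (∫⁻ x, g x ∂μ + ∫⁻ x, h x ∂μ) ^ (1 / 2 : ℝ) := by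
        rw [ENNReal.mul_rpow_of_nonneg _ _ (by norm_num),
          ENNReal.ofReal_rpow_of_nonneg (sq_nonneg c) (by norm_num), ← Real.sqrt_eq_rpow,
          Real.sqrt_sq hc]
    _ ≤ _ := by
        gcongr
        exact ENNReal.rpow_add_le_add_rpow _ _ (by norm_num) (by norm_num)

/-- Sobolev-norm decay for the linear damped wave equation on the Fourier side: if for each
`ξ` the function `t ↦ u(t,ξ)` solves `∂²_t u + b ∂_t u + (m + |ξ|²) u = 0` with data `u₀, u₁`,
then the `H^s`-type quantity of `u(t, ·)` decays exponentially, uniformly controlled by the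
`H^s` norm of `u₀` and the `H^{s-1}` norm of `u₁`. -/
theorem damped_wave_fourier_decay (d : ℕ) (hd : 1 ≤ d) (b m : ℝ) (hb : 0 < b) (hm : 0 < m) :
    ∃ C > (0 : ℝ), ∃ δ > (0 : ℝ), ∀ (s : ℝ)
      (u : ℝ → EuclideanSpace ℝ (Fin d) → ℂ) (u₀ u₁ : EuclideanSpace ℝ (Fin d) → ℂ),
      (∀ ξ, Differentiable ℝ fun t : ℝ => u t ξ) →
      (∀ ξ, Differentiable ℝ (deriv fun t : ℝ => u t ξ)) →
      (∀ ξ, ∀ t : ℝ, 0 ≤ t →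
        deriv (deriv fun t' : ℝ => u t' ξ) t + (b : ℂ) * deriv (fun t' : ℝ => u t' ξ) t
          + ((m + ‖ξ‖ ^ 2 : ℝ) : ℂ) * u t ξ = 0) →
      (∀ ξ, u 0 ξ = u₀ ξ) →
      (∀ ξ, deriv (fun t' : ℝ => u t' ξ) 0 = u₁ ξ) →
      (∀ t : ℝ, Measurable (u t)) → Measurable u₀ → Measurable u₁ →
      ∀ t : ℝ, 0 ≤ t →
        (∫⁻ ξ, ENNReal.ofReal ((1 + ‖ξ‖ ^ 2) ^ s) * (‖u t ξ‖₊ : ℝ≥0∞) ^ 2) ^ (1 / 2 : ℝ)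
          ≤ ENNReal.ofReal (C * Real.exp (-δ * t)) *
            ((∫⁻ ξ, ENNReal.ofReal ((1 + ‖ξ‖ ^ 2) ^ s) * (‖u₀ ξ‖₊ : ℝ≥0∞) ^ 2) ^ (1 / 2 : ℝ)
              + (∫⁻ ξ, ENNReal.ofReal ((1 + ‖ξ‖ ^ 2) ^ (s - 1)) * (‖u₁ ξ‖₊ : ℝ≥0∞) ^ 2)
                  ^ (1 / 2 : ℝ)) := by
  set a : ℝ := b * m / (3 * (b ^ 2 + m)) with ha_def
  have hden : 0 < 3 * (b ^ 2 + m) := by positivity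
  have ha : 0 < a := by positivity
  have hab : 3 * a ≤ b := by
    have : a ≤ b / 3 := by
      rw [ha_def, div_le_div_iff₀ hden (by norm_num)]
      nlinarith [pow_pos hb 3]
    linarith
  have habm : 3 * (a * b) ≤ m := by
    have : a * b ≤ m / 3 := by
      rw [ha_def, div_mul_eq_mul_div, div_le_div_iff₀ hden (by norm_num)]
      nlinarith [pow_pos hm 2]
    linarith
  have hK : 0 < 3 * (1 + 1 / m) := by positivity
  refine ⟨√(3 * (1 + 1 / m)), Real.sqrt_pos.mpr hK, a / 2, by positivity, ?_⟩
  intro s u u₀ u₁ hu hu' hode h₀ h₁ _ hu₀ _ t ht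
  refine lintegral_rpow_half_le_of_le_add (by fun_prop) (by positivity) fun ξ => ?_
  have hM : m ≤ m + ‖ξ‖ ^ 2 := by linarith [sq_nonneg ‖ξ‖]
  have hMpos : 0 < m + ‖ξ‖ ^ 2 := by linarith
  have hdecay := damped_oscillator_decay ha hab (habm.trans hM) (hu ξ) (hu' ξ)
    (fun t ht => by simpa only [Complex.real_smul] using hode ξ t ht) ht
  rw [h₀, h₁] at hdecay
  have hwpos : 0 < 1 + ‖ξ‖ ^ 2 := by positivity
  have hexp : (√(3 * (1 + 1 / m)) * Real.exp (-(a / 2) * t)) ^ 2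
      = 3 * (1 + 1 / m) * Real.exp (-a * t) := by
    rw [mul_pow, Real.sq_sqrt hK.le, ← Real.exp_nat_mul]
    congr 2
    push_cast
    ring
  have hweight : 1 + ‖ξ‖ ^ 2 ≤ (1 + 1 / m) * (m + ‖ξ‖ ^ 2) := by
    have h : (1 + 1 / m) * (m + ‖ξ‖ ^ 2) = 1 + ‖ξ‖ ^ 2 + m + ‖ξ‖ ^ 2 / m := by
      field_simp
      ring
    rw [h]
    have : 0 ≤ ‖ξ‖ ^ 2 / m := by positivity
    linarith
  have hinv : 1 / (m + ‖ξ‖ ^ 2) ≤ (1 + 1 / m) / (1 + ‖ξ‖ ^ 2) := by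
    rwa [div_le_div_iff₀ hMpos hwpos, one_mul]
  have hone : 1 ≤ 1 + 1 / m := by
    have : 0 < 1 / m := by positivity
    linarith
  have hpoint : ‖u t ξ‖ ^ 2 ≤ 3 * (1 + 1 / m) * Real.exp (-a * t) *
      (‖u₀ ξ‖ ^ 2 + ‖u₁ ξ‖ ^ 2 / (1 + ‖ξ‖ ^ 2)) := by
    calc ‖u t ξ‖ ^ 2
        ≤ 3 * Real.exp (-a * t) * (‖u₁ ξ‖ ^ 2 + (m + ‖ξ‖ ^ 2) * ‖u₀ ξ‖ ^ 2) / (m + ‖ξ‖ ^ 2) := by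
          rw [le_div_iff₀ hMpos, mul_comm]
          exact hdecay
      _ = 3 * Real.exp (-a * t) * (1 * ‖u₀ ξ‖ ^ 2 + 1 / (m + ‖ξ‖ ^ 2) * ‖u₁ ξ‖ ^ 2) := by
          field_simp
          ring
      _ ≤ 3 * Real.exp (-a * t) *
            ((1 + 1 / m) * ‖u₀ ξ‖ ^ 2 + (1 + 1 / m) / (1 + ‖ξ‖ ^ 2) * ‖u₁ ξ‖ ^ 2) := by
          gcongr
      _ = _ := by ring
  have hnorm : ∀ z : ℂ, (‖z‖₊ : ℝ≥0∞) ^ 2 = ENNReal.ofReal (‖z‖ ^ 2) := fun z => by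
    rw [ENNReal.ofReal_pow (norm_nonneg z), ofReal_norm, enorm_eq_nnnorm]
  have hws : 0 ≤ (1 + ‖ξ‖ ^ 2) ^ s := by positivity
  have hws' : 0 ≤ (1 + ‖ξ‖ ^ 2) ^ (s - 1) := by positivity
  rw [hexp, hnorm, hnorm, hnorm, ← ENNReal.ofReal_mul hws, ← ENNReal.ofReal_mul hws,
    ← ENNReal.ofReal_mul hws', ← ENNReal.ofReal_add (by positivity) (by positivity),
    ← ENNReal.ofReal_mul (by positivity)]
  refine ENNReal.ofReal_le_ofReal ?_
  rw [Real.rpow_sub_one hwpos.ne']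
  exact (mul_le_mul_of_nonneg_left hpoint hws).trans_eq (by ring)
end
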